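/- Let n ≥ 1, let f : Z_2^n → Z_2, let s ∈ Z_2^n, and define g : Z_2^n → Z_2 by g(x) = f(x+s). If for some b ∈ Z_2 and u ∈ Z_2^n the amplitude 2^{−n} Σ_{x ∈ Z_2^n, f(x) ⊕ g(x) = b} (−1)^{f(x)}·(−1)^{⟨u,x⟩} is nonzero, then ⟨u,s⟩ = b. In other words, every measurement outcome (b,u) of the sampling subroutine yields a valid linear equation on the hidden shift s. -/

import Mathlib

theorem ZMod.neg_one_pow_val_add {R : Type*} [Ring R] (a c : ZMod 2) :
    (-1 : R) ^ (a + c).val = (-1) ^ a.val * (-1) ^ c.val := by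
  rw [ZMod.val_add, neg_one_pow_eq_pow_mod_two, Nat.mod_mod, ← neg_one_pow_eq_pow_mod_two, pow_add]

theorem ZMod.sign_mul_add_sign_mul_eq_zero {R : Type*} [CommRing R] {a c w : ZMod 2}
    (h : w ≠ a + c) (d : ZMod 2) :
    (-1 : R) ^ a.val * (-1) ^ d.val + (-1) ^ c.val * (-1) ^ (d + w).val = 0 := by
  have hw : c + w = a + 1 := by
    revert a c w
    decide
  have hs : (-1 : R) ^ c.val * (-1) ^ w.val = -(-1) ^ a.val := by
    rw [← ZMod.neg_one_pow_val_add, hw, ZMod.neg_one_pow_val_add, ZMod.val_one, pow_one,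
      mul_neg_one]
  rw [ZMod.neg_one_pow_val_add]
  linear_combination (-1 : R) ^ d.val * hs


/-- If `g(x) = f(x+s)` and for some `b ∈ Z_2`, `u ∈ Z_2^n` the amplitude
`2^{-n} ∑_{x : f(x)⊕g(x)=b} (-1)^{f(x)} (-1)^{⟨u,x⟩}` is nonzero, then `⟨u,s⟩ = b`:
every measurement outcome `(b,u)` of the sampling subroutine yields a valid linear
equation on the hidden shift `s`. -/
theorem measurement_outcome_valid_equation (n : ℕ) (hn : 1 ≤ n)
    (f g : (Fin n → ZMod 2) → ZMod 2) (s : Fin n → ZMod 2)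
    (hg : ∀ x, g x = f (x + s)) (b : ZMod 2) (u : Fin n → ZMod 2)
    (hamp : (2 ^ n : ℝ)⁻¹ *
        ∑ x ∈ Finset.univ.filter fun x : Fin n → ZMod 2 => f x + g x = b,
          (-1 : ℝ) ^ (f x).val * (-1 : ℝ) ^ (∑ i, u i * x i : ZMod 2).val ≠ 0) :
    (∑ i, u i * s i) = b := by
  by_contra hne
  refine hamp (mul_eq_zero_of_right _ ?_)
  have hss (x : Fin n → ZMod 2) : x + s + s = x := by
    ext i
    simp [add_assoc, CharTwo.add_self_eq_zero]
  have hcancel : ∀ x ∈ Finset.univ.filter fun x : Fin n → ZMod 2 => f x + g x = b,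
      (-1 : ℝ) ^ (f x).val * (-1 : ℝ) ^ (∑ i, u i * x i : ZMod 2).val +
        (-1 : ℝ) ^ (f (x + s)).val * (-1 : ℝ) ^ (∑ i, u i * (x + s) i : ZMod 2).val = 0 := by
    intro x hx
    simp only [Finset.mem_filter, Finset.mem_univ, true_and, hg] at hx
    simp only [Pi.add_apply, mul_add, Finset.sum_add_distrib]
    exact ZMod.sign_mul_add_sign_mul_eq_zero (hx.symm ▸ hne) _
  refine Finset.sum_involution (fun x _ => x + s) hcancel ?_ ?_ fun x _ => hss x
  · intro x hx hx0 hfix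
    have h := hcancel x hx
    rw [hfix] at h
    exact hx0 (self_eq_neg.mp (eq_neg_of_add_eq_zero_left h))
  · intro x hx
    simpa [hg, hss, add_comm (f (x + s))] using hx
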